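/- If K ⊆ ℝⁿ is nonempty, compact, and convex, and F : K → ℝⁿ is continuous, then the solution set of the variational inequality VI(K,F) is nonempty. -/

import Mathlib

open RealInnerProductSpace

open MeasureTheory Metric

section MetricProjection

variable {E : Type*} [NormedAddCommGroup E] [InnerProductSpace ℝ E]

/-- The metric projection onto a nonempty complete convex set, characterised by its variational
inequality, exists. -/
theorem exists_metricProjection {K : Set E} (hne : K.Nonempty) (hK : IsComplete K)
    (hconv : Convex ℝ K) :
    ∃ P : E → E, (∀ x, P x ∈ K) ∧ ∀ x, ∀ w ∈ K, ⟪x - P x, w - P x⟫ ≤ 0 := by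
  choose P hP hmin using exists_norm_eq_iInf_of_complete_convex hne hK hconv
  exact ⟨P, hP, fun x => (norm_eq_iInf_iff_real_inner_le_zero hconv (hP x)).1 (hmin x)⟩

theorem eq_self_of_inner_nonpos {K : Set E} {P : E → E}
    (hvar : ∀ x, ∀ w ∈ K, ⟪x - P x, w - P x⟫ ≤ 0) {x : E} (hx : x ∈ K) : P x = x := by
  have h := hvar x x hx
  rw [real_inner_self_nonpos] at h
  exact (sub_eq_zero.1 h).symm

theorem norm_sub_le_of_inner_nonpos {K : Set E} {P : E → E} (hP : ∀ x, P x ∈ K)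
    (hvar : ∀ x, ∀ w ∈ K, ⟪x - P x, w - P x⟫ ≤ 0) (x y : E) : ‖P x - P y‖ ≤ ‖x - y‖ := by
  have h1 := hvar x (P y) (hP y)
  have h2 := hvar y (P x) (hP x)
  have h3 : ‖P x - P y‖ ^ 2 ≤ ⟪x - y, P x - P y⟫ := by
    have e : ⟪x - y, P x - P y⟫ - ⟪P x - P y, P x - P y⟫
        = -⟪x - P x, P y - P x⟫ - ⟪y - P y, P x - P y⟫ := by
      simp only [inner_sub_left, inner_sub_right]
      ring
    rw [← real_inner_self_eq_norm_sq]
    linarith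
  have h4 := real_inner_le_norm (x - y) (P x - P y)
  by_contra! h
  nlinarith [norm_nonneg (x - y), norm_nonneg (P x - P y)]

/-- The projection onto a closed ball sends points outside the ball to its boundary sphere. -/
theorem norm_eq_of_inner_nonpos_closedBall {ρ : ℝ} (hρ : 0 ≤ ρ) {P : E → E}
    (hP : ∀ x, P x ∈ closedBall (0 : E) ρ)
    (hvar : ∀ x, ∀ w ∈ closedBall (0 : E) ρ, ⟪x - P x, w - P x⟫ ≤ 0) {x : E}
    (hx : x ∉ closedBall (0 : E) ρ) : ‖P x‖ = ρ := by
  refine le_antisymm (mem_closedBall_zero_iff.1 (hP x)) ?_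
  set d := x - P x with hd
  have hd0 : d ≠ 0 := fun h => hx ((sub_eq_zero.1 (hd.symm.trans h)).symm ▸ hP x)
  have hdpos : 0 < ‖d‖ := norm_pos_iff.2 hd0
  have hw : (ρ / ‖d‖) • d ∈ closedBall (0 : E) ρ := by
    rw [mem_closedBall_zero_iff, norm_smul, Real.norm_of_nonneg (by positivity)]
    field_simp
    exact le_rfl
  have h := hvar x _ hw
  rw [← hd, inner_sub_right, inner_smul_right, real_inner_self_eq_norm_sq] at h
  have h' := real_inner_le_norm d (P x)
  have e : ρ / ‖d‖ * ‖d‖ ^ 2 = ρ * ‖d‖ := by field_simp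
  rw [e] at h
  nlinarith

end MetricProjection

theorem ContinuousLinearMap.det_id_add_eq_sum_lagrange {E : Type*} [NormedAddCommGroup E]
    [NormedSpace ℝ E] [FiniteDimensional ℝ E] (A : E →L[ℝ] E) {s : Finset ℝ}
    (hs : Module.finrank ℝ E < s.card) :
    (ContinuousLinearMap.id ℝ E + A).det =
      ∑ t ∈ s, (ContinuousLinearMap.id ℝ E + t • A).det * (Lagrange.basis s id t).eval 1 := by
  let b := Module.finBasis ℝ E
  let M := LinearMap.toMatrix b b (A : E →ₗ[ℝ] E)
  let p : Polynomial ℝ :=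
    ((Polynomial.X : Polynomial ℝ) • M.map Polynomial.C +
      (1 : Matrix (Fin (Module.finrank ℝ E)) (Fin (Module.finrank ℝ E)) ℝ).map Polynomial.C).det
  have hp : ∀ t : ℝ, p.eval t = (ContinuousLinearMap.id ℝ E + t • A).det := by
    intro t
    rw [ContinuousLinearMap.det, ← LinearMap.det_toMatrix b, ← Polynomial.coe_evalRingHom,
      RingHom.map_det]
    congr 1
    ext i j
    simp [M, Matrix.one_apply, LinearMap.toMatrix_apply, Finsupp.single_apply, apply_ite,
      eq_comm, add_comm]
    exact mul_comm _ _
  have hdeg : p.degree < s.card := by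
    refine Polynomial.degree_le_natDegree.trans_lt ?_
    have := Polynomial.natDegree_det_X_add_C_le M 1
    rw [Fintype.card_fin] at this
    exact_mod_cast this.trans_lt hs
  have h := congrArg (Polynomial.eval 1)
    (Lagrange.eq_interpolate (v := id) Function.injective_id.injOn hdeg)
  simpa [Lagrange.interpolate_apply, Polynomial.eval_finsetSum, hp] using h

theorem exists_forall_det_id_add_pos {E : Type*} [NormedAddCommGroup E] [NormedSpace ℝ E]
    [FiniteDimensional ℝ E] :
    ∃ δ > 0, ∀ A : E →L[ℝ] E, ‖A‖ < δ → 0 < (ContinuousLinearMap.id ℝ E + A).det := by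
  have hcont : Continuous fun A : E →L[ℝ] E => (ContinuousLinearMap.id ℝ E + A).det :=
    ContinuousLinearMap.continuous_det.comp (continuous_const.add continuous_id)
  have h0 : (0 : E →L[ℝ] E) ∈ {A : E →L[ℝ] E | 0 < (ContinuousLinearMap.id ℝ E + A).det} := by
    simp [ContinuousLinearMap.det]
  obtain ⟨δ, hδ, hball⟩ := Metric.isOpen_iff.1 (isOpen_lt continuous_const hcont) 0 h0
  exact ⟨δ, hδ, fun A hA => hball (by simpa using hA)⟩

section Retraction

variable {E : Type*} [NormedAddCommGroup E] [InnerProductSpace ℝ E] [FiniteDimensional ℝ E]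

/-- A map of constant nonzero norm has singular derivative. -/
theorem det_fderiv_eq_zero_of_norm_eq {r : E → E} {ρ : ℝ} (hρ : 0 < ρ) (hr : Differentiable ℝ r)
    (hnorm : ∀ x, ‖r x‖ = ρ) (x : E) : (fderiv ℝ r x).det = 0 := by
  by_contra h
  have hsurj : Function.Surjective (fderiv ℝ r x) :=
    (LinearMap.equivOfDetNeZero (fderiv ℝ r x : E →ₗ[ℝ] E) h).surjective
  obtain ⟨v, hv⟩ := hsurj (r x)
  have h1 : HasFDerivAt (fun y => ⟪r y, r y⟫) _ x :=
    (hr x).hasFDerivAt.inner ℝ (hr x).hasFDerivAt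
  have h2 : (fun y => ⟪r y, r y⟫) = fun _ => ρ ^ 2 := by
    ext y
    rw [real_inner_self_eq_norm_sq, hnorm]
  rw [h2] at h1
  have h3 := congrArg (fun L => L v) (h1.unique (hasFDerivAt_const (ρ ^ 2) x))
  simp [hv, hnorm] at h3
  exact hρ.ne' h3

/-- If `h` is Lipschitz on a closed ball and vanishes on its sphere, then `id + t • h` covers the
ball for small `t`. -/
theorem closedBall_subset_image_id_add_smul {h : E → E} {ρ M t : ℝ} (hρ : 0 ≤ ρ)
    (hM : ∀ x ∈ closedBall (0 : E) ρ, ∀ y ∈ closedBall (0 : E) ρ, ‖h x - h y‖ ≤ M * ‖x - y‖)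
    (hM0 : 0 ≤ M) (hsphere : ∀ x, ‖x‖ = ρ → h x = 0) (ht0 : 0 ≤ t) (ht : t * M < 1) :
    closedBall (0 : E) ρ ⊆ (fun x => x + t • h x) '' closedBall (0 : E) ρ := by
  intro y hy
  obtain ⟨P, hP, hvar⟩ := exists_metricProjection (nonempty_closedBall.2 hρ)
    (isCompact_closedBall (0 : E) ρ).isComplete (convex_closedBall (0 : E) ρ)
  have hc : ContractingWith (t * M).toNNReal fun x => y - t • h (P x) := by
    refine ⟨Real.toNNReal_lt_one.2 ht, LipschitzWith.of_dist_le_mul fun a b => ?_⟩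
    rw [dist_eq_norm, dist_eq_norm, sub_sub_sub_cancel_left, ← smul_sub, norm_smul,
      Real.norm_of_nonneg ht0, Real.coe_toNNReal _ (by positivity), mul_assoc]
    gcongr
    rw [norm_sub_rev a b]
    exact (hM _ (hP b) _ (hP a)).trans
      (mul_le_mul_of_nonneg_left (norm_sub_le_of_inner_nonpos hP hvar b a) hM0)
  set x := hc.fixedPoint
  have hx : y - t • h (P x) = x := hc.fixedPoint_isFixedPt
  have hxB : x ∈ closedBall (0 : E) ρ := by
    by_contra hxB
    rw [hsphere _ (norm_eq_of_inner_nonpos_closedBall hρ hP hvar hxB), smul_zero, sub_zero] at hx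
    exact hxB (hx ▸ hy)
  rw [eq_self_of_inner_nonpos hvar hxB] at hx
  exact ⟨x, hxB, (sub_eq_iff_eq_add.1 hx).symm⟩

/-- There is no `C¹` retraction onto the sphere of a Euclidean ball. The proof is that of Milnor
and Rogers. -/
theorem not_exists_contDiff_retraction {r : E → E} {ρ : ℝ} (hρ : 0 < ρ) (hr : ContDiff ℝ 1 r)
    (hnorm : ∀ x, ‖r x‖ = ρ) (hid : ∀ x, ‖x‖ = ρ → r x = x) : False := by
  borelize E
  let μ : Measure E := Measure.addHaar
  set B := closedBall (0 : E) ρ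
  have hBc : IsCompact B := isCompact_closedBall 0 ρ
  have hBconv : Convex ℝ B := convex_closedBall 0 ρ
  let h : E → E := fun x => r x - x
  have hh : ContDiff ℝ 1 h := hr.sub contDiff_id
  have hhd : Differentiable ℝ h := hh.differentiable one_ne_zero
  have hDh : Continuous (fderiv ℝ h) := hh.continuous_fderiv one_ne_zero
  obtain ⟨M', hM'⟩ := hBc.exists_bound_of_continuousOn hDh.continuousOn
  let M := max M' 1
  have hM1 : 1 ≤ M := le_max_right _ _
  have hM : ∀ x ∈ B, ‖fderiv ℝ h x‖ ≤ M := fun x hx => (hM' x hx).trans (le_max_left _ _)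
  have hlip : ∀ x ∈ B, ∀ y ∈ B, ‖h x - h y‖ ≤ M * ‖x - y‖ := fun x hx y hy =>
    hBconv.norm_image_sub_le_of_norm_fderiv_le (fun z _ => hhd z) hM hy hx
  obtain ⟨δ, hδ, hdet⟩ := exists_forall_det_id_add_pos (E := E)
  let J : ℝ → E → ℝ := fun t x => (ContinuousLinearMap.id ℝ E + t • fderiv ℝ h x).det
  have hJcont : ∀ t, Continuous (J t) := fun t =>
    ContinuousLinearMap.continuous_det.comp (continuous_const.add (hDh.const_smul t))
  have hJint : ∀ t, IntegrableOn (J t) B μ := fun t =>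
    (hJcont t).continuousOn.integrableOn_compact hBc
  have hsmall : ∀ t ∈ Set.Ioo 0 (min 1 δ / M), ∫ x in B, J t x ∂μ = μ.real B := by
    rintro t ⟨ht0, ht⟩
    rw [lt_div_iff₀ (by positivity), lt_min_iff] at ht
    have ht1 : t < 1 := by nlinarith
    have himage : (fun x => x + t • h x) '' B = B := by
      refine Set.Subset.antisymm ?_ (closedBall_subset_image_id_add_smul hρ.le hlip
        (by positivity) (fun x hx => by simp [h, hid x hx]) ht0.le ht.1)
      rintro _ ⟨x, hx, rfl⟩
      have hrx : r x ∈ B := by simp [B, hnorm]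
      have := hBconv hx hrx (a := 1 - t) (b := t) (by linarith) ht0.le (by ring)
      convert this using 1
      simp only [h]
      module
    have hinj : Set.InjOn (fun x => x + t • h x) B := by
      intro x hx y hy hxy
      have e : x - y = t • (h y - h x) := by
        simp only at hxy
        rw [smul_sub, sub_eq_sub_iff_add_eq_add, hxy, add_comm]
      have h1 : ‖x - y‖ ≤ t * (M * ‖x - y‖) := by
        conv_lhs => rw [e, norm_smul, Real.norm_of_nonneg ht0.le, norm_sub_rev]
        gcongr
        exact hlip x hx y hy
      have h2 : ‖x - y‖ = 0 := by nlinarith [norm_nonneg (x - y), ht.1]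
      exact sub_eq_zero.1 (norm_eq_zero.1 h2)
    have hcv := integral_image_eq_integral_abs_det_fderiv_smul μ hBc.measurableSet
      (fun x _ => ((hasFDerivAt_id x).add
        ((hhd x).hasFDerivAt.const_smul t)).hasFDerivWithinAt) hinj (fun _ => (1 : ℝ))
    have hcv' : ∫ x in B, |J t x| ∂μ = μ.real B := by
      change ∫ x in (fun x => x + t • h x) '' B, (1 : ℝ) ∂μ = _ at hcv
      rw [himage] at hcv
      simpa [J] using hcv.symm
    rw [← hcv']
    refine setIntegral_congr_fun hBc.measurableSet fun x hx => (abs_of_pos (hdet _ ?_)).symm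
    rw [norm_smul, Real.norm_of_nonneg ht0.le]
    exact (mul_le_mul_of_nonneg_left (hM x hx) ht0.le).trans_lt ht.2
  obtain ⟨s, hs, hcard⟩ := (Set.Ioo_infinite (show (0 : ℝ) < min 1 δ / M by positivity)
    ).exists_subset_card_eq (Module.finrank ℝ E + 1)
  have hJ1 : ∀ x, J 1 x = ∑ t ∈ s, J t x * (Lagrange.basis s id t).eval 1 := fun x => by
    simpa only [J, one_smul] using
      (fderiv ℝ h x).det_id_add_eq_sum_lagrange (s := s) (by omega)
  have hsum : ∑ t ∈ s, (Lagrange.basis s id t).eval (1 : ℝ) = 1 := by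
    have := congrArg (Polynomial.eval (1 : ℝ)) (Lagrange.sum_basis (s := s) (v := id)
      Function.injective_id.injOn (Finset.card_pos.1 (by omega)))
    simpa [Polynomial.eval_finsetSum] using this
  have hvol : ∫ x in B, J 1 x ∂μ = μ.real B := by
    simp_rw [hJ1]
    rw [integral_finsetSum _ fun t _ => (hJint t).mul_const _]
    simp_rw [integral_mul_const]
    rw [Finset.sum_congr rfl fun t ht => by rw [hsmall t (hs ht)], ← Finset.mul_sum, hsum,
      mul_one]
  have hzero : ∀ x, J 1 x = 0 := fun x => by
    have hrd := hr.differentiable one_ne_zero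
    have : fderiv ℝ h x = fderiv ℝ r x - ContinuousLinearMap.id ℝ E :=
      ((hrd x).hasFDerivAt.sub (hasFDerivAt_id x)).fderiv
    simp only [J, one_smul, this, add_sub_cancel]
    exact det_fderiv_eq_zero_of_norm_eq hρ hrd hnorm x
  have hpos : 0 < μ.real B := ENNReal.toReal_pos
    (measure_closedBall_pos μ 0 hρ).ne' hBc.measure_lt_top.ne
  simp [hzero] at hvol
  linarith

/-- **Brouwer's fixed point theorem** for bounded continuous self-maps of a Euclidean space. -/
theorem exists_fixedPoint_of_continuous_of_bounded {q : E → E} (hq : Continuous q) {R : ℝ}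
    (hR : 0 < R) (hbound : ∀ x, ‖q x‖ ≤ R) : ∃ x, q x = x := by
  by_contra! hfix
  let χ : ContDiffBump (0 : E) := ⟨R, 2 * R, hR, by linarith⟩
  have hχ : ContDiff ℝ 1 χ := χ.contDiff
  let ρ := 3 * R
  have hρ : 0 < ρ := by positivity
  have hne : ∀ x, x - χ x • q x ≠ 0 := fun x hx => by
    have hx' : x = χ x • q x := sub_eq_zero.1 hx
    have hxR : ‖x‖ ≤ R := by
      rw [hx', norm_smul, Real.norm_of_nonneg χ.nonneg]
      nlinarith [χ.le_one (x := x), χ.nonneg (x := x), hbound x, norm_nonneg (q x)]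
    rw [χ.one_of_mem_closedBall (by simpa using hxR), one_smul] at hx'
    exact hfix x hx'.symm
  obtain ⟨x₀, -, hmin⟩ := (isCompact_closedBall (0 : E) ρ).exists_isMinOn
    (nonempty_closedBall.2 hρ.le)
    (continuous_id.sub (hχ.continuous.smul hq)).norm.continuousOn
  obtain ⟨g, hg, hgq, -⟩ := hq.exists_contDiff_approx 1
    (continuous_const (y := ‖x₀ - χ x₀ • q x₀‖)) fun _ => norm_pos_iff.2 (hne x₀)
  let G : E → E := fun x => x - χ x • g x
  have hG : ContDiff ℝ 1 G := contDiff_id.sub (hχ.smul hg)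
  have hGout : ∀ x, 2 * R ≤ ‖x‖ → G x = x := fun x hx => by
    have : χ x = 0 := χ.zero_of_le_dist (by simpa using hx)
    simp [G, this]
  have hGne : ∀ x, G x ≠ 0 := fun x hx => by
    rcases le_total (2 * R) ‖x‖ with hxR | hxR
    · rw [hGout x hxR] at hx
      rw [hx, norm_zero] at hxR
      linarith
    · have hxB : x ∈ closedBall (0 : E) ρ := by
        rw [mem_closedBall_zero_iff]
        simp only [ρ]
        linarith
      have h1 : ‖x₀ - χ x₀ • q x₀‖ ≤ ‖x - χ x • q x‖ := hmin hxB
      have h2 : x - χ x • q x = χ x • (g x - q x) := by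
        rw [smul_sub, ← sub_eq_zero.1 hx]
      have h3 := hgq x
      rw [dist_eq_norm] at h3
      rw [h2, norm_smul, Real.norm_of_nonneg χ.nonneg] at h1
      nlinarith [χ.le_one (x := x), norm_nonneg (g x - q x)]
  refine not_exists_contDiff_retraction (r := fun x => (ρ / ‖G x‖) • G x) hρ
    ((contDiff_const.div (hG.norm ℝ hGne) fun x => norm_ne_zero_iff.2 (hGne x)).smul hG)
    (fun x => ?_) fun x hx => ?_
  · have := norm_pos_iff.2 (hGne x)
    rw [norm_smul, Real.norm_of_nonneg (by positivity)]
    field_simp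
  · rw [hGout x (by rw [hx]; simp only [ρ]; linarith), hx, div_self hρ.ne', one_smul]

end Retraction

/-- if K is nonempty compact convex and F is continuous on K, then
VI(K,F) has a solution. -/
theorem stmt_2 (n : ℕ) (K : Set (EuclideanSpace ℝ (Fin n)))
    (hne : K.Nonempty) (hcpt : IsCompact K) (hconv : Convex ℝ K)
    (F : EuclideanSpace ℝ (Fin n) → EuclideanSpace ℝ (Fin n))
    (hF : ContinuousOn F K) :
    ∃ x ∈ K, ∀ y ∈ K, 0 ≤ ⟪F x, y - x⟫ := by
  obtain ⟨P, hP, hvar⟩ := exists_metricProjection hne hcpt.isComplete hconv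
  have hPcont : Continuous P := (LipschitzWith.of_dist_le_mul (K := 1) fun x y => by
    simpa [dist_eq_norm] using norm_sub_le_of_inner_nonpos hP hvar x y).continuous
  obtain ⟨R, hR⟩ := hcpt.isBounded.exists_norm_le
  have hq : Continuous fun x => P (P x - F (P x)) :=
    hPcont.comp (hPcont.sub (hF.comp_continuous hPcont hP))
  obtain ⟨x, hx⟩ := exists_fixedPoint_of_continuous_of_bounded hq
    (lt_max_of_lt_right one_pos : (0 : ℝ) < max R 1)
    fun x => (hR _ (hP _)).trans (le_max_left _ _)
  have hxK : x ∈ K := hx ▸ hP _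
  have hPx : P x = x := eq_self_of_inner_nonpos hvar hxK
  refine ⟨x, hxK, fun y hy => ?_⟩
  have h := hvar (P x - F (P x)) y hy
  rw [hx, hPx, sub_sub_cancel_left, inner_neg_left] at h
  linarith
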